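/- Unweighted adversary bound via the spectral method: let R ⊆ A × B be a relation between disjoint sets A, B of bit strings in {0,1}^N, with every x ∈ A appearing in at least m pairs and every y ∈ B in at least m' pairs of R, and for each index i, every x ∈ A appears in at most ℓ pairs of R_i = {(x,y) ∈ R : x_i ≠ y_i} and every y ∈ B in at most ℓ' pairs of R_i. Then there exists a nonnegative symmetric matrix Γ indexed by A ∪ B, supported on pairs in the symmetrization of R, with λ(Γ) ≥ 1 and λ(Γ_i) ≤ √(ℓℓ'/(mm')) for all i, where Γ_i[x,y] = Γ[x,y] if x_i ≠ y_i and 0 otherwise. -/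

import Mathlib

/-- Spectral norm (largest singular value) of a real matrix. -/
noncomputable def specNorm {n : Type*} [Fintype n] [DecidableEq n] (M : Matrix n n ℝ) : ℝ :=
  ‖Matrix.toEuclideanCLM (𝕜 := ℝ) M‖

/-- A matrix fixing a nonzero vector has spectral norm at least one. -/
theorem one_le_specNorm_of_mulVec_eq {n : Type*} [Fintype n] [DecidableEq n]
    {M : Matrix n n ℝ} {v : n → ℝ} (hv : v ≠ 0) (h : M.mulVec v = v) : 1 ≤ specNorm M := by
  have hle := (Matrix.toEuclideanCLM (𝕜 := ℝ) M).le_opNorm (WithLp.toLp 2 v)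
  rw [Matrix.toEuclideanCLM_toLp, h] at hle
  have hpos : 0 < ‖WithLp.toLp 2 v‖ := by simpa using hv
  exact le_of_mul_le_mul_right (by simpa [specNorm] using hle) hpos

/-- A Schur test: if `M` is the entrywise product of `a` and `b`, the squared row norms of `a`
are at most `r`, and the `r`-weighted squared column norms of `b` are at most `K`, then the
spectral norm of `M` is at most `√K`. -/
theorem specNorm_le_sqrt_of_schur {n : Type*} [Fintype n] [DecidableEq n]
    {M : Matrix n n ℝ} {a b : n → n → ℝ} {r : n → ℝ} {K : ℝ}
    (hM : ∀ x y, M x y = a x y * b x y) (ha : ∀ x, ∑ y, a x y ^ 2 ≤ r x)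
    (hb : ∀ y, ∑ x, r x * b x y ^ 2 ≤ K) : specNorm M ≤ √K := by
  refine ContinuousLinearMap.opNorm_le_bound _ (Real.sqrt_nonneg _) fun v => ?_
  rw [EuclideanSpace.norm_eq, EuclideanSpace.norm_eq v,
    ← Real.sqrt_mul' _ (Finset.sum_nonneg fun _ _ => sq_nonneg _)]
  apply Real.sqrt_le_sqrt
  simp only [Matrix.ofLp_toEuclideanCLM, Matrix.mulVec, dotProduct,
    Real.norm_eq_abs, sq_abs]
  calc ∑ x, (∑ y, M x y * v y) ^ 2
      ≤ ∑ x, r x * ∑ y, (b x y * v y) ^ 2 := by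
        gcongr with x
        simp only [hM, mul_assoc]
        refine (Finset.sum_mul_sq_le_sq_mul_sq _ _ _).trans ?_
        exact mul_le_mul_of_nonneg_right (ha x) (Finset.sum_nonneg fun _ _ => sq_nonneg _)
    _ = ∑ y, (∑ x, r x * b x y ^ 2) * v y ^ 2 := by
        simp only [Finset.mul_sum, Finset.sum_mul]
        rw [Finset.sum_comm]
        exact Finset.sum_congr rfl fun _ _ => Finset.sum_congr rfl fun _ _ => by ring
    _ ≤ ∑ y, K * v y ^ 2 := by
        gcongr with y
        exact hb y
    _ = K * ∑ y, v y ^ 2 := by rw [Finset.mul_sum]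

/-- The number of `S`-neighbours of `x`. -/
def relDegree {n : Type*} [Fintype n] (S : n → n → Prop) [DecidableRel S] (x : n) : ℕ :=
  (Finset.univ.filter (S x)).card

/-- The adjacency matrix of `S`, normalized by the square roots of the degrees. -/
noncomputable def normalizedAdj {n : Type*} [Fintype n] (S : n → n → Prop) [DecidableRel S] :
    Matrix n n ℝ :=
  Matrix.of fun x y => if S x y then (√(relDegree S x))⁻¹ * (√(relDegree S y))⁻¹ else 0

theorem relDegree_pos {n : Type*} [Fintype n] {S : n → n → Prop} [DecidableRel S] {x y : n}
    (h : S x y) : 0 < relDegree S x :=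
  Finset.card_pos.mpr ⟨y, by simpa using h⟩

theorem one_le_specNorm_normalizedAdj {n : Type*} [Fintype n] [DecidableEq n]
    {S : n → n → Prop} [DecidableRel S] (hS : ∀ x y, S x y → S y x) {x₀ y₀ : n}
    (h₀ : S x₀ y₀) : 1 ≤ specNorm (normalizedAdj S) := by
  refine one_le_specNorm_of_mulVec_eq (v := fun x => √(relDegree S x)) ?_ ?_
  · intro h
    have hpos : (0 : ℝ) < √(relDegree S x₀) := by
      have := relDegree_pos h₀
      positivity
    exact hpos.ne' (congrFun h x₀)
  · ext x
    have hterm (y : n) : normalizedAdj S x y * √(relDegree S y)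
        = if S x y then (√(relDegree S x))⁻¹ else 0 := by
      by_cases h : S x y
      · have hpos : (0 : ℝ) < √(relDegree S y) := by
          have := relDegree_pos (hS _ _ h)
          positivity
        simp [normalizedAdj, h, hpos.ne']
      · simp [normalizedAdj, h]
    simp only [Matrix.mulVec, dotProduct, hterm]
    rw [← Finset.sum_filter, Finset.sum_const, nsmul_eq_mul]
    exact Real.div_sqrt

/-- The part of a normalized adjacency matrix supported on a symmetric subrelation `T` has
spectral norm at most `√K` if the fraction of neighbours of `x` that are `T`-neighbours is at
most `r x`, where `r x * r y ≤ K` on neighbours, in the form that `r` of every neighbour of `y`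
is `r' y` and `r' y * r y ≤ K`. -/
theorem specNorm_normalizedAdj_restrict_le {n : Type*} [Fintype n] [DecidableEq n]
    {S P : n → n → Prop} [DecidableRel S] [DecidableRel P]
    (hS : ∀ x y, S x y → S y x) (hP : ∀ x y, P x y → P y x) {r r' : n → ℝ} {K : ℝ}
    (hr : ∀ x, (relDegree (fun x y => S x y ∧ P x y) x : ℝ) / relDegree S x ≤ r x)
    (hr' : ∀ x y, S x y → r x = r' y) (hr'0 : ∀ y, 0 ≤ r' y) (hK : ∀ y, r' y * r y ≤ K) :
    specNorm (Matrix.of fun x y => if P x y then normalizedAdj S x y else 0) ≤ √K := by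
  refine specNorm_le_sqrt_of_schur (r := r)
    (a := fun x y => if S x y ∧ P x y then (√(relDegree S x))⁻¹ else 0)
    (b := fun x y => if S x y ∧ P x y then (√(relDegree S y))⁻¹ else 0) ?_ ?_ ?_
  · intro x y
    by_cases hs : S x y <;> by_cases hp : P x y <;> simp [normalizedAdj, hs, hp]
  · intro x
    refine le_of_eq_of_le ?_ (hr x)
    simp only [ite_pow, inv_pow, Real.sq_sqrt (Nat.cast_nonneg _), ne_eq, OfNat.ofNat_ne_zero,
      not_false_eq_true, zero_pow]
    rw [← Finset.sum_filter, Finset.sum_const, nsmul_eq_mul, ← div_eq_mul_inv]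
    rfl
  · intro y
    refine le_trans (le_of_eq ?_) ((mul_le_mul_of_nonneg_left (hr y) (hr'0 y)).trans (hK y))
    have hterm (x : n) :
        r x * (if S x y ∧ P x y then (√(relDegree S y))⁻¹ else 0) ^ 2
          = if S y x ∧ P y x then r' y * (relDegree S y : ℝ)⁻¹ else 0 := by
      by_cases h : S x y ∧ P x y
      · rw [if_pos h, if_pos ⟨hS _ _ h.1, hP _ _ h.2⟩, hr' x y h.1, inv_pow,
          Real.sq_sqrt (Nat.cast_nonneg _)]
      · rw [if_neg h, if_neg fun h' => h ⟨hS _ _ h'.1, hP _ _ h'.2⟩]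
        simp
    simp only [hterm]
    rw [← Finset.sum_filter, Finset.sum_const, nsmul_eq_mul]
    change (relDegree (fun x y => S x y ∧ P x y) y : ℝ) * _ = _
    ring

/-- If the pairs of `R` with first entry `x` biject with the `S`-neighbours of `x`, degrees can
be counted in `R`. -/
theorem relDegree_eq_card_filter_fst {n : Type*} [Fintype n] [DecidableEq n]
    {S : n → n → Prop} [DecidableRel S] {R : Finset (n × n)} {Q : n × n → Prop}
    [DecidablePred Q] {x : n} (h : ∀ y, S x y ↔ (x, y) ∈ R ∧ Q (x, y)) :
    relDegree S x = (R.filter fun p => p.1 = x ∧ Q p).card := by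
  refine Finset.card_bij (fun y _ => (x, y)) ?_ ?_ ?_
  · intro y hy
    have := (h y).mp (by simpa using hy)
    simpa using this
  · intro y _ z _ e
    exact (Prod.ext_iff.mp e).2
  · rintro ⟨a, y⟩ hp
    obtain ⟨hR, rfl, hQ⟩ := Finset.mem_filter.mp hp
    exact ⟨y, by simpa using (h y).mpr ⟨hR, hQ⟩, rfl⟩

/-- If the pairs of `R` with second entry `y` biject with the `S`-neighbours of `y`, degrees can
be counted in `R`. -/
theorem relDegree_eq_card_filter_snd {n : Type*} [Fintype n] [DecidableEq n]
    {S : n → n → Prop} [DecidableRel S] {R : Finset (n × n)} {Q : n × n → Prop}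
    [DecidablePred Q] {y : n} (h : ∀ x, S y x ↔ (x, y) ∈ R ∧ Q (x, y)) :
    relDegree S y = (R.filter fun p => p.2 = y ∧ Q p).card := by
  refine Finset.card_bij (fun x _ => (x, y)) ?_ ?_ ?_
  · intro x hx
    have := (h x).mp (by simpa using hx)
    simpa using this
  · intro x _ z _ e
    exact (Prod.ext_iff.mp e).1
  · rintro ⟨x, b⟩ hp
    obtain ⟨hR, rfl, hQ⟩ := Finset.mem_filter.mp hp
    exact ⟨x, by simpa using (h x).mpr ⟨hR, hQ⟩, rfl⟩

/-- Unweighted adversary bound via the spectral method: from a relation `R ⊆ A × B`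
with minimum degrees `m, m'` and maximum degrees `ℓ, ℓ'` in the `R_i`, one obtains
an adversary matrix `Γ` with `λ(Γ) ≥ 1` and `λ(Γ_i) ≤ √(ℓℓ'/(mm'))`. -/
theorem stmt_9 (N : ℕ) (A B : Finset (Fin N → Bool))
    (hAB : Disjoint A B) (hA : A.Nonempty) (hB : B.Nonempty)
    (R : Finset ((Fin N → Bool) × (Fin N → Bool)))
    (hR : ∀ p ∈ R, p.1 ∈ A ∧ p.2 ∈ B)
    (m m' ℓ ℓ' : ℕ) (hm : 0 < m) (hm' : 0 < m')
    (hdegA : ∀ x ∈ A, m ≤ (R.filter (fun p => p.1 = x)).card)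
    (hdegB : ∀ y ∈ B, m' ≤ (R.filter (fun p => p.2 = y)).card)
    (hℓ : ∀ i : Fin N, ∀ x ∈ A, (R.filter (fun p => p.1 = x ∧ p.1 i ≠ p.2 i)).card ≤ ℓ)
    (hℓ' : ∀ i : Fin N, ∀ y ∈ B, (R.filter (fun p => p.2 = y ∧ p.1 i ≠ p.2 i)).card ≤ ℓ') :
    ∃ Γ : Matrix (Fin N → Bool) (Fin N → Bool) ℝ,
      (∀ x y, Γ x y = Γ y x) ∧
      (∀ x y, 0 ≤ Γ x y) ∧
      (∀ x y, Γ x y ≠ 0 → (x, y) ∈ R ∨ (y, x) ∈ R) ∧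
      1 ≤ specNorm Γ ∧
      ∀ i : Fin N,
        specNorm (Matrix.of fun x y => if x i ≠ y i then Γ x y else 0)
          ≤ Real.sqrt ((ℓ * ℓ' : ℝ) / (m * m')) := by
  classical
  let S : (Fin N → Bool) → (Fin N → Bool) → Prop := fun x y => (x, y) ∈ R ∨ (y, x) ∈ R
  have hS : ∀ x y, S x y → S y x := fun _ _ h => h.symm
  have hAB' : ∀ x ∈ A, x ∉ B := fun x hx hx' => Finset.disjoint_left.mp hAB hx hx'
  have hSA : ∀ x ∈ A, ∀ y, S x y ↔ (x, y) ∈ R := fun x hx y =>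
    ⟨fun h => h.resolve_right fun h' => hAB' x hx (hR _ h').2, Or.inl⟩
  have hSB : ∀ y ∈ B, ∀ x, S y x ↔ (x, y) ∈ R := fun y hy x =>
    ⟨fun h => h.resolve_left fun h' => hAB' y (hR _ h').1 hy, Or.inr⟩
  have hmA : ∀ x ∈ A, m ≤ relDegree S x := fun x hx => by
    rw [relDegree_eq_card_filter_fst (R := R) (Q := fun _ => True) (by simpa using hSA x hx)]
    simpa using hdegA x hx
  have hmB : ∀ y ∈ B, m' ≤ relDegree S y := fun y hy => by
    rw [relDegree_eq_card_filter_snd (R := R) (Q := fun _ => True) (by simpa using hSB y hy)]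
    simpa using hdegB y hy
  refine ⟨normalizedAdj S, ?_, ?_, ?_, ?_, ?_⟩
  · intro x y
    have : S x y ↔ S y x := ⟨hS _ _, hS _ _⟩
    simp only [normalizedAdj, Matrix.of_apply, this, mul_comm]
  · intro x y
    simp only [normalizedAdj, Matrix.of_apply]
    split_ifs <;> positivity
  · intro x y h
    by_contra hne
    exact h (if_neg hne)
  · obtain ⟨x, hx⟩ := hA
    obtain ⟨y, hy⟩ := Finset.card_pos.mp (hm.trans_le (hmA x hx))
    exact one_le_specNorm_normalizedAdj hS (Finset.mem_filter.mp hy).2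
  · intro i
    refine specNorm_normalizedAdj_restrict_le (P := fun x y => x i ≠ y i)
      (r := fun x => if x ∈ A then (ℓ / m : ℝ) else ℓ' / m')
      (r' := fun x => if x ∈ A then (ℓ' / m' : ℝ) else ℓ / m) hS (fun _ _ => Ne.symm) ?_ ?_ ?_ ?_
    · intro x
      by_cases hx : x ∈ A
      · have hd : relDegree (fun x y => S x y ∧ x i ≠ y i) x ≤ ℓ := by
          rw [relDegree_eq_card_filter_fst (R := R) (Q := fun p => p.1 i ≠ p.2 i)
            fun y => by rw [hSA x hx]]
          exact hℓ i x hx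
        have := hmA x hx
        simp only [hx, if_true]
        gcongr
      · simp only [hx, if_false]
        by_cases hxB : x ∈ B
        · have hd : relDegree (fun x y => S x y ∧ x i ≠ y i) x ≤ ℓ' := by
            rw [relDegree_eq_card_filter_snd (R := R) (Q := fun p => p.1 i ≠ p.2 i)
              fun y => by rw [hSB x hxB, ne_comm]]
            exact hℓ' i x hxB
          have := hmB x hxB
          gcongr
        · have hd : relDegree S x = 0 := by
            by_contra hne
            obtain ⟨y, hy⟩ := Finset.card_pos.mp (Nat.pos_of_ne_zero hne)
            rcases (Finset.mem_filter.mp hy).2 with h | h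
            · exact hx (hR _ h).1
            · exact hxB (hR _ h).2
          rw [hd, Nat.cast_zero, div_zero]
          positivity
    · rintro x y (h | h)
      · have hy : y ∉ A := fun hy => hAB' y hy (hR _ h).2
        simp [(hR _ h).1, hy]
      · have hx : x ∉ A := fun hx => hAB' x hx (hR _ h).2
        simp [(hR _ h).1, hx]
    · intro y
      split_ifs <;> positivity
    · intro y
      split_ifs
      · exact le_of_eq (by rw [div_mul_div_comm, mul_comm (ℓ' : ℝ), mul_comm (m' : ℝ)])
      · exact le_of_eq (by rw [div_mul_div_comm])
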